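/- Define the Ricci map Ric(t,s) = (6 + 8t²/s², 28 − 14t/s) for t,s > 0. Given (t,s) ∈ (0,∞)², there exists a sequence ((t_i,s_i))_{i≤1} of elements of (0,∞)² with (t₁,s₁) = (t,s) and (t_{i−1},s_{i−1}) = Ric(t_i,s_i) for every integer i ≤ 1 if and only if t/s ≤ 1. Moreover, if t/s < 1, then for any such sequence, (t_i,s_i) converges to (798/121, 266/11) as i → −∞. -/

import Mathlib

open Filter Topology

/-- The Ricci map for the `Spin(9)`-invariant metrics `g_{t,s}` on `S^{15}`:
`Ric(t,s) = (6 + 8t²/s², 28 − 14t/s)`. -/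
noncomputable def RicS15 (p : ℝ × ℝ) : ℝ × ℝ :=
  (6 + 8 * p.1 ^ 2 / p.2 ^ 2, 28 - 14 * p.1 / p.2)

/-- The map induced by `RicS15` on the ratios `t / s`. -/
noncomputable def ratioMap (r : ℝ) : ℝ := (6 + 8 * r ^ 2) / (28 - 14 * r)

lemma ricS15_eq_ratio (p : ℝ × ℝ) :
    RicS15 p = (6 + 8 * (p.1 / p.2) ^ 2, 28 - 14 * (p.1 / p.2)) := by
  simp only [RicS15, div_pow, mul_div_assoc]

lemma ricS15_ratio (p : ℝ × ℝ) :
    (RicS15 p).1 / (RicS15 p).2 = ratioMap (p.1 / p.2) := by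
  rw [ricS15_eq_ratio]
  rfl

lemma ratioMap_sub_one {r : ℝ} (hr : r < 2) :
    ratioMap r - 1 = (r - 1) * ((4 * r + 11) / (7 * (2 - r))) := by
  have h : 2 - r ≠ 0 := by linarith
  rw [ratioMap, show 28 - 14 * r = 14 * (2 - r) by ring]
  field_simp
  ring

lemma ratioMap_sub_fixed {r : ℝ} (hr : r < 2) :
    ratioMap r - 3 / 11 = (r - 3 / 11) * ((4 * r + 3) / (7 * (2 - r))) := by
  have h : 2 - r ≠ 0 := by linarith
  rw [ratioMap, show 28 - 14 * r = 14 * (2 - r) by ring]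
  field_simp
  ring

lemma ratioMap_le_one {r : ℝ} (h0 : 0 < r) (hr : r ≤ 1) : ratioMap r ≤ 1 := by
  unfold ratioMap
  rw [div_le_one (by linarith)]
  nlinarith

lemma ratioMap_le {r M : ℝ} (h0 : 0 < r) (hr : r ≤ M) (hM : 3 / 11 ≤ M) (hM1 : M < 1) :
    ratioMap r ≤ M := by
  unfold ratioMap
  rw [div_le_iff₀ (by linarith)]
  nlinarith [mul_nonneg (sub_nonneg.2 hM) (sub_nonneg.2 hM1.le),
    mul_nonneg (sub_nonneg.2 hr) h0.le, mul_nonneg (sub_nonneg.2 hr) (h0.le.trans hr)]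

lemma ratioMap_contracts {r M : ℝ} (h0 : 0 < r) (hr : r ≤ M) (hM1 : M < 1) :
    |ratioMap r - 3 / 11| ≤ (4 * M + 3) / (7 * (2 - M)) * |r - 3 / 11| := by
  rw [ratioMap_sub_fixed (by linarith), abs_mul, mul_comm]
  refine mul_le_mul_of_nonneg_right ?_ (abs_nonneg _)
  rw [abs_of_pos (div_pos (by linarith) (by linarith))]
  exact div_le_div₀ (by linarith) (by linarith) (by linarith) (by linarith)

lemma ratio_le_one_of_orbit {r : ℕ → ℝ} (h2 : ∀ n, r n < 2)
    (hr : ∀ n, r (n + 1) = ratioMap (r n)) : r 0 ≤ 1 := by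
  by_contra! h
  have key : ∀ n, 1 < r n ∧ 2 ^ n * (r 0 - 1) ≤ r n - 1 := by
    intro n
    induction n with
    | zero => exact ⟨h, by simp⟩
    | succ n ih =>
      obtain ⟨h1, ih⟩ := ih
      have hf : 2 ≤ (4 * r n + 11) / (7 * (2 - r n)) := by
        rw [le_div_iff₀ (by linarith [h2 n])]
        linarith
      have hstep : 2 * (r n - 1) ≤ r (n + 1) - 1 := by
        rw [hr, ratioMap_sub_one (h2 n)]
        nlinarith
      exact ⟨by linarith, by rw [pow_succ]; linarith⟩
  obtain ⟨n, hn⟩ := pow_unbounded_of_one_lt (1 / (r 0 - 1)) (one_lt_two : (1 : ℝ) < 2)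
  rw [div_lt_iff₀ (by linarith)] at hn
  linarith [(key n).2, h2 n]

lemma ratio_tendsto_of_orbit {r : ℕ → ℝ} (h0 : ∀ n, 0 < r n)
    (hr : ∀ n, r (n + 1) = ratioMap (r n)) (h1 : r 0 < 1) :
    Tendsto r atTop (𝓝 (3 / 11)) := by
  obtain ⟨M, hM0, hM, hM1⟩ : ∃ M : ℝ, r 0 ≤ M ∧ 3 / 11 ≤ M ∧ M < 1 :=
    ⟨max (r 0) (3 / 11), le_max_left _ _, le_max_right _ _, max_lt h1 (by norm_num)⟩
  have hle : ∀ n, r n ≤ M := by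
    intro n
    induction n with
    | zero => exact hM0
    | succ n ih =>
      rw [hr]
      exact ratioMap_le (h0 n) ih hM hM1
  set q := (4 * M + 3) / (7 * (2 - M)) with hq
  have hq0 : 0 ≤ q := div_nonneg (by linarith) (by linarith)
  have hq1 : q < 1 := by
    rw [hq, div_lt_one (by linarith)]
    linarith
  have hbound : ∀ n, |r n - 3 / 11| ≤ q ^ n * |r 0 - 3 / 11| := by
    intro n
    induction n with
    | zero => simp
    | succ n ih =>
      calc |r (n + 1) - 3 / 11| ≤ q * |r n - 3 / 11| := by
            rw [hr]
            exact ratioMap_contracts (h0 n) (hle n) hM1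
        _ ≤ q * (q ^ n * |r 0 - 3 / 11|) := mul_le_mul_of_nonneg_left ih hq0
        _ = q ^ (n + 1) * |r 0 - 3 / 11| := by ring
  rw [tendsto_iff_norm_sub_tendsto_zero]
  refine squeeze_zero (fun _ => norm_nonneg _) hbound ?_
  simpa using (tendsto_pow_atTop_nhds_zero_of_lt_one hq0 hq1).mul_const |r 0 - 3 / 11|

lemma ricS15_pos {p : ℝ × ℝ} (hp : p.1 / p.2 < 2) :
    0 < (RicS15 p).1 ∧ 0 < (RicS15 p).2 := by
  rw [ricS15_eq_ratio]
  exact ⟨by positivity, by simp only; linarith⟩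

lemma iterate_ricS15_pos {p : ℝ × ℝ} (h1 : 0 < p.1) (h2 : 0 < p.2) (h : p.1 / p.2 ≤ 1) (n : ℕ) :
    (0 < (RicS15^[n] p).1 ∧ 0 < (RicS15^[n] p).2) ∧
      (RicS15^[n] p).1 / (RicS15^[n] p).2 ≤ 1 := by
  induction n with
  | zero => exact ⟨⟨h1, h2⟩, h⟩
  | succ n ih =>
    obtain ⟨⟨hp1, hp2⟩, hle⟩ := ih
    rw [Function.iterate_succ_apply']
    refine ⟨ricS15_pos (by linarith), ?_⟩
    rw [ricS15_ratio]
    exact ratioMap_le_one (div_pos hp1 hp2) hle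

lemma orbit_tendsto {u : ℕ → ℝ × ℝ} (hpos : ∀ n, 0 < (u n).1 ∧ 0 < (u n).2)
    (hu : ∀ n, u (n + 1) = RicS15 (u n)) (h1 : (u 0).1 / (u 0).2 < 1) :
    Tendsto u atTop (𝓝 ((798 / 121 : ℝ), (266 / 11 : ℝ))) := by
  have hr : Tendsto (fun n => (u n).1 / (u n).2) atTop (𝓝 (3 / 11)) :=
    ratio_tendsto_of_orbit (fun n => div_pos (hpos n).1 (hpos n).2)
      (fun n => by rw [hu, ricS15_ratio]) h1
  rw [← tendsto_add_atTop_iff_nat 1]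
  simp only [hu, ricS15_eq_ratio]
  have h := (((hr.pow 2).const_mul 8).const_add 6).prodMk_nhds ((hr.const_mul 14).const_sub 28)
  convert h using 3 <;> norm_num

theorem stmt_5 (t s : ℝ) (ht : 0 < t) (hs : 0 < s) :
    ((∃ x : ℤ → ℝ × ℝ,
        (∀ i ≤ (1 : ℤ), 0 < (x i).1 ∧ 0 < (x i).2) ∧ x 1 = (t, s) ∧
        ∀ i ≤ (1 : ℤ), x (i - 1) = RicS15 (x i)) ↔ t / s ≤ 1) ∧
    (t / s < 1 → ∀ x : ℤ → ℝ × ℝ,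
        (∀ i ≤ (1 : ℤ), 0 < (x i).1 ∧ 0 < (x i).2) → x 1 = (t, s) →
        (∀ i ≤ (1 : ℤ), x (i - 1) = RicS15 (x i)) →
        Tendsto x atBot (𝓝 ((798 / 121 : ℝ), (266 / 11 : ℝ)))) := by
  have hstep : ∀ x : ℤ → ℝ × ℝ, (∀ i ≤ (1 : ℤ), x (i - 1) = RicS15 (x i)) →
      ∀ n : ℕ, x (1 - ((n + 1 : ℕ) : ℤ)) = RicS15 (x (1 - (n : ℤ))) := by
    intro x hx n
    rw [← hx _ (by omega)]
    congr 1
    push_cast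
    ring
  refine ⟨⟨?_, ?_⟩, ?_⟩
  · rintro ⟨x, hpos, hx1, hx⟩
    have h := ratio_le_one_of_orbit (r := fun n : ℕ => (x (1 - (n : ℤ))).1 / (x (1 - (n : ℤ))).2)
      (fun n => by
        have h := (hpos (1 - ((n + 1 : ℕ) : ℤ)) (by omega)).2
        rw [hstep x hx, ricS15_eq_ratio] at h
        simp only at h ⊢
        linarith)
      (fun n => by simp only [hstep x hx, ricS15_ratio])
    simpa [hx1] using h
  · intro h
    refine ⟨fun i => RicS15^[(1 - i).toNat] (t, s), fun i _ => ?_, by simp, fun i hi => ?_⟩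
    · exact (iterate_ricS15_pos (p := (t, s)) ht hs h _).1
    · have hn : (1 - (i - 1)).toNat = (1 - i).toNat + 1 := by omega
      simp only [hn, Function.iterate_succ_apply']
  · intro h x hpos hx1 hx
    have hlim := orbit_tendsto (u := fun n : ℕ => x (1 - (n : ℤ)))
      (fun n => hpos _ (by omega)) (hstep x hx) (by simpa [hx1] using h)
    have hidx : Tendsto (fun i : ℤ => (1 - i).toNat) atBot atTop := by
      refine tendsto_atTop.2 fun n => ?_
      filter_upwards [eventually_le_atBot (1 - (n : ℤ))] with i hi
      omega
    refine (hlim.comp hidx).congr' ?_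
    filter_upwards [eventually_le_atBot (1 : ℤ)] with i hi
    simp only [Function.comp_apply]
    congr 1
    omega
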